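/- arXiv:1708.05510 — 2 statements merged into one kernel-verified Lean document; each statement's English description precedes it below -/
import Mathlib

section
/- Let P be a finite nonempty set of unit vectors in Euclidean space ℝⁿ, let y ∈ ℝⁿ with ‖y‖₂ = 1, and let ν ≥ 0. Let x* ∈ P maximize the inner product with y over P, and suppose x ∈ P satisfies ‖x − y‖₂ ≤ (1+ν)·min_{p∈P} ‖p − y‖₂. For a real threshold K, define K̂ := 1 + (1+ν)²·(K − 1). If K̂ ≥ x·y, then K ≥ x*·y. -/
open scoped RealInnerProductSpace

/-- If `x` is a `(1+ν)`-approximate nearest neighbor of the unit query `y` among the finite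
nonempty set `P` of unit vectors, `xstar ∈ P` maximizes the inner product with `y`, and
`K̂ := 1 + (1+ν)^2 * (K - 1)` satisfies `K̂ ≥ ⟪x, y⟫`, then `K ≥ ⟪xstar, y⟫`. -/
theorem approx_nn_threshold_update
    {n : ℕ} (P : Finset (EuclideanSpace ℝ (Fin n))) (hP : P.Nonempty)
    (hunit : ∀ p ∈ P, ‖p‖ = 1)
    (y : EuclideanSpace ℝ (Fin n)) (hy : ‖y‖ = 1)
    (ν : ℝ) (hν : 0 ≤ ν)
    (xstar : EuclideanSpace ℝ (Fin n)) (hxstarP : xstar ∈ P)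
    (hxstar : ∀ p ∈ P, ⟪p, y⟫ ≤ ⟪xstar, y⟫)
    (x : EuclideanSpace ℝ (Fin n)) (hxP : x ∈ P)
    (hx : ‖x - y‖ ≤ (1 + ν) * P.inf' hP (fun p => ‖p - y‖))
    (K : ℝ) (hK : 1 + (1 + ν) ^ 2 * (K - 1) ≥ ⟪x, y⟫) :
    K ≥ ⟪xstar, y⟫ := by
  have dist_sq : ∀ p ∈ P, ‖p - y‖ ^ 2 = 2 - 2 * ⟪p, y⟫ := fun p hp => by
    rw [norm_sub_sq_real, hunit p hp, hy]
    ring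
  have hle : ‖x - y‖ ≤ (1 + ν) * ‖xstar - y‖ :=
    hx.trans (mul_le_mul_of_nonneg_left (P.inf'_le (fun p => ‖p - y‖) hxstarP) (by linarith))
  have hsq := pow_le_pow_left₀ (norm_nonneg _) hle 2
  rw [mul_pow, dist_sq x hxP, dist_sq xstar hxstarP] at hsq
  have hmul : (1 + ν) ^ 2 * ⟪xstar, y⟫ ≤ (1 + ν) ^ 2 * K := by linarith
  exact le_of_mul_le_mul_left hmul (by positivity)
end

section
/- Let P be a finite nonempty set of unit vectors in ℝⁿ, let y be a unit vector, ν ≥ 0, let x* ∈ P maximize the inner product with y, and let x ∈ P satisfy ‖x − y‖₂ ≤ (1+ν)·min_{p∈P} ‖p − y‖₂. For a real threshold K with K̂ := 1 + (1+ν)²·(K − 1), the following binary-search update rules are all valid: (a) if K̂ ≥ x·y then K ≥ x*·y; (b) if K ≤ x·y then K ≤ x*·y; (c) if K̂ ≤ x·y and K ≥ x·y, then K̂ ≤ x*·y. -/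
open scoped RealInnerProductSpace

/-- For unit vectors, the squared distance is twice the inner-product deficit. -/
theorem norm_sub_sq_of_norm_eq_one {E : Type*} [NormedAddCommGroup E] [InnerProductSpace ℝ E]
    {p y : E} (hp : ‖p‖ = 1) (hy : ‖y‖ = 1) : ‖p - y‖ ^ 2 = 2 * (1 - ⟪p, y⟫) := by
  rw [norm_sub_sq_real, hp, hy]
  ring

/-- A unit vector within a factor `c` of the distance from `q` to `y` has inner product with `y`
at least `1 + c ^ 2 * (⟪q, y⟫ - 1)`. -/
theorem le_inner_of_norm_sub_le_mul {E : Type*} [NormedAddCommGroup E] [InnerProductSpace ℝ E]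
    {x q y : E} (hx : ‖x‖ = 1) (hq : ‖q‖ = 1) (hy : ‖y‖ = 1) {c : ℝ}
    (h : ‖x - y‖ ≤ c * ‖q - y‖) : 1 + c ^ 2 * (⟪q, y⟫ - 1) ≤ ⟪x, y⟫ := by
  have hsq : ‖x - y‖ ^ 2 ≤ (c * ‖q - y‖) ^ 2 := pow_le_pow_left₀ (norm_nonneg _) h 2
  rw [mul_pow, norm_sub_sq_of_norm_eq_one hx hy, norm_sub_sq_of_norm_eq_one hq hy] at hsq
  linarith

/-- Validity of the three binary-search update rules of Assort-MNL-Approx: with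
`K̂ := 1 + (1+ν)^2 * (K - 1)`, (a) `K̂ ≥ ⟪x, y⟫ → K ≥ ⟪xstar, y⟫`;
(b) `K ≤ ⟪x, y⟫ → K ≤ ⟪xstar, y⟫`; (c) `K̂ ≤ ⟪x, y⟫ ∧ K ≥ ⟪x, y⟫ → K̂ ≤ ⟪xstar, y⟫`. -/
theorem approx_nn_binary_search_updates
    {n : ℕ} (P : Finset (EuclideanSpace ℝ (Fin n))) (hP : P.Nonempty)
    (hunit : ∀ p ∈ P, ‖p‖ = 1)
    (y : EuclideanSpace ℝ (Fin n)) (hy : ‖y‖ = 1)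
    (ν : ℝ) (hν : 0 ≤ ν)
    (xstar : EuclideanSpace ℝ (Fin n)) (hxstarP : xstar ∈ P)
    (hxstar : ∀ p ∈ P, ⟪p, y⟫ ≤ ⟪xstar, y⟫)
    (x : EuclideanSpace ℝ (Fin n)) (hxP : x ∈ P)
    (hx : ‖x - y‖ ≤ (1 + ν) * P.inf' hP (fun p => ‖p - y‖))
    (K : ℝ) :
    (1 + (1 + ν) ^ 2 * (K - 1) ≥ ⟪x, y⟫ → K ≥ ⟪xstar, y⟫) ∧
    (K ≤ ⟪x, y⟫ → K ≤ ⟪xstar, y⟫) ∧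
    (1 + (1 + ν) ^ 2 * (K - 1) ≤ ⟪x, y⟫ ∧ K ≥ ⟪x, y⟫ →
      1 + (1 + ν) ^ 2 * (K - 1) ≤ ⟪xstar, y⟫) := by
  have hxy : ⟪x, y⟫ ≤ ⟪xstar, y⟫ := hxstar x hxP
  have hdist : ‖x - y‖ ≤ (1 + ν) * ‖xstar - y‖ :=
    hx.trans (mul_le_mul_of_nonneg_left (Finset.inf'_le _ hxstarP) (by linarith))
  have hlow := le_inner_of_norm_sub_le_mul (hunit x hxP) (hunit xstar hxstarP) hy hdist
  refine ⟨fun h => ?_, fun h => h.trans hxy, fun h => h.1.trans hxy⟩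
  have hpos : 0 < (1 + ν) ^ 2 := by positivity
  have hmul : (1 + ν) ^ 2 * (⟪xstar, y⟫ - 1) ≤ (1 + ν) ^ 2 * (K - 1) := by linarith
  linarith [le_of_mul_le_mul_left hmul hpos]
end
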